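/- arXiv:2402.08097 — 2 statements merged into one kernel-verified Lean document; each statement's English description precedes it below -/
import Mathlib

section
/- Under the AGM-BiO iteration with step sizes a_k = (k+1)/(4 L_f), if at iteration k ≥ 1 the condition f(x_k) ≥ f(x*) holds, then the accumulated squared displacements of the z-iterates satisfy ∑_{i=0}^{k−1} ‖z_{i+1} − z_i‖² ≤ 2 ‖z_0 − x*‖². -/
open RealInnerProductSpace

section Smooth

variable {E : Type*} [NormedAddCommGroup E] [InnerProductSpace ℝ E] [CompleteSpace E]
  {f : E → ℝ} {f' : E → E} {L : ℝ}

/-- The derivative of a differentiable function along a line. -/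
theorem HasGradientAt.hasDerivAt_comp_lineMap (hf' : ∀ w, HasGradientAt f (f' w) w)
    (u v : E) (t : ℝ) :
    HasDerivAt (fun s : ℝ => f (AffineMap.lineMap u v s))
      ⟪f' (AffineMap.lineMap u v t), v - u⟫ t := by
  simpa [Function.comp_def] using
    (hf' (AffineMap.lineMap u v t)).hasFDerivAt.comp_hasDerivAt t AffineMap.hasDerivAt_lineMap

/-- A convex function lies above its tangent planes. -/
theorem ConvexOn.add_inner_gradient_le (hf : ConvexOn ℝ Set.univ f)
    (hf' : ∀ w, HasGradientAt f (f' w) w) (u v : E) :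
    f u + ⟪f' u, v - u⟫ ≤ f v := by
  have hc : ConvexOn ℝ Set.univ (fun s : ℝ => f (AffineMap.lineMap u v s)) :=
    hf.comp_affineMap (AffineMap.lineMap u v : ℝ →ᵃ[ℝ] E)
  have h := hc.le_slope_of_hasDerivAt (Set.mem_univ 0) (Set.mem_univ 1) one_pos
    (HasGradientAt.hasDerivAt_comp_lineMap hf' u v 0)
  simp [slope_def_field] at h
  linarith

/-- The descent lemma: quadratic upper bound for a function with Lipschitz gradient. -/
theorem le_add_inner_gradient_add_sq (hf' : ∀ w, HasGradientAt f (f' w) w)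
    (hL : ∀ u v, ‖f' u - f' v‖ ≤ L * ‖u - v‖) (u v : E) :
    f v ≤ f u + ⟪f' u, v - u⟫ + L / 2 * ‖v - u‖ ^ 2 := by
  have hd (t : ℝ) : HasDerivAt
      (fun s : ℝ => f (AffineMap.lineMap u v s) -
        (s * ⟪f' u, v - u⟫ + s ^ 2 * (L / 2 * ‖v - u‖ ^ 2)))
      (⟪f' (AffineMap.lineMap u v t), v - u⟫ -
        (1 * ⟪f' u, v - u⟫ + (2 * t) * (L / 2 * ‖v - u‖ ^ 2))) t := by
    refine (HasGradientAt.hasDerivAt_comp_lineMap hf' u v t).sub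
      (((hasDerivAt_id t).mul_const _).add (HasDerivAt.mul_const ?_ _))
    simpa using hasDerivAt_pow 2 t
  have hanti := antitoneOn_of_hasDerivWithinAt_nonpos (convex_Ici (0 : ℝ))
    (fun t _ => (hd t).continuousAt.continuousWithinAt)
    (fun t _ => (hd t).hasDerivWithinAt) (fun t ht => by
      have ht0 : 0 < t := by simpa using ht
      have hlip := hL (AffineMap.lineMap u v t) u
      have hnorm : ‖AffineMap.lineMap u v t - u‖ = t * ‖v - u‖ := by
        rw [AffineMap.lineMap_apply, vsub_eq_sub, vadd_eq_add, add_sub_cancel_right, norm_smul,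
          Real.norm_of_nonneg ht0.le]
      have hcs := real_inner_le_norm (f' (AffineMap.lineMap u v t) - f' u) (v - u)
      rw [inner_sub_left] at hcs
      rw [hnorm] at hlip
      have := mul_le_mul_of_nonneg_right hlip (norm_nonneg (v - u))
      nlinarith)
  have h := hanti (Set.mem_Ici.2 le_rfl) (Set.mem_Ici.2 zero_le_one) zero_le_one
  simp at h
  linarith

/-- One step of an accelerated projected gradient method decreases the potential
`A * (f x - f w) + ‖z - w‖ ^ 2 / 2` up to the squared displacement of `z`. -/
theorem accelerated_step_potential_le (hf : ConvexOn ℝ Set.univ f)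
    (hf' : ∀ w, HasGradientAt f (f' w) w)
    (hL : ∀ u v, ‖f' u - f' v‖ ≤ L * ‖u - v‖) {A a : ℝ} (hA : 0 ≤ A) (ha : 0 < a)
    (hstep : 2 * L * a ^ 2 ≤ A + a) {x y z x₁ z₁ w : E}
    (hy : y = (A / (A + a)) • x + (a / (A + a)) • z)
    (hx₁ : x₁ = (A / (A + a)) • x + (a / (A + a)) • z₁)
    (hproj : ⟪z - a • f' y - z₁, w - z₁⟫ ≤ 0) :
    (A + a) * (f x₁ - f w) + ‖z₁ - w‖ ^ 2 / 2 + ‖z₁ - z‖ ^ 2 / 4 ≤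
      A * (f x - f w) + ‖z - w‖ ^ 2 / 2 := by
  have hS : 0 < A + a := by linarith
  have hdiff : x₁ - y = (a / (A + a)) • (z₁ - z) := by
    rw [hx₁, hy]; module
  have hdescent := le_add_inner_gradient_add_sq hf' hL y x₁
  have hx := hf.add_inner_gradient_le hf' y x
  have hw := hf.add_inner_gradient_le hf' y w
  have hxy : A • (x - y) = a • (y - z) := by
    have h : (A + a) • y = A • x + a • z := by
      rw [hy, smul_add, smul_smul, smul_smul, mul_div_cancel₀ _ hS.ne', mul_div_cancel₀ _ hS.ne']
    rw [add_smul, ← sub_eq_zero] at h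
    rw [← sub_eq_zero, ← neg_eq_zero, ← h]
    module
  have hxy' : A * ⟪f' y, x - y⟫ = a * ⟪f' y, y - z⟫ := by
    rw [← real_inner_smul_right, hxy, real_inner_smul_right]
  have hnorm : (A + a) * (L / 2 * ‖x₁ - y‖ ^ 2) ≤ ‖z₁ - z‖ ^ 2 / 4 := by
    rw [hdiff, norm_smul, mul_pow, Real.norm_eq_abs, sq_abs]
    have : (A + a) * (L / 2 * ((a / (A + a)) ^ 2 * ‖z₁ - z‖ ^ 2)) =
        (2 * L * a ^ 2 / (A + a)) * (‖z₁ - z‖ ^ 2 / 4) := by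
      field_simp; ring
    rw [this]
    exact mul_le_of_le_one_left (by positivity) ((div_le_one hS).2 hstep)
  have hinner : (A + a) * ⟪f' y, x₁ - y⟫ = a * ⟪f' y, z₁ - z⟫ := by
    rw [hdiff, real_inner_smul_right, ← mul_assoc, mul_div_cancel₀ _ hS.ne']
  have hthree : ‖z - w‖ ^ 2 = ‖z₁ - z‖ ^ 2 + ‖z₁ - w‖ ^ 2 - 2 * ⟪z - z₁, w - z₁⟫ := by
    rw [show z - w = (z - z₁) - (w - z₁) by abel, norm_sub_sq_real, norm_sub_rev z z₁,
      norm_sub_rev w z₁]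
    ring
  have hsplit : ⟪z - a • f' y - z₁, w - z₁⟫ =
      ⟪z - z₁, w - z₁⟫ - a * ⟪f' y, w - z₁⟫ := by
    rw [← real_inner_smul_left, ← inner_sub_left]; congr 1; abel
  have hsum : ⟪f' y, w - z₁⟫ = ⟪f' y, w - y⟫ + ⟪f' y, y - z⟫ - ⟪f' y, z₁ - z⟫ := by
    rw [← inner_add_right, ← inner_sub_right]; congr 1; abel
  rw [hsplit, hsum] at hproj
  have h₁ := mul_le_mul_of_nonneg_left hdescent hS.le
  have h₂ := mul_le_mul_of_nonneg_left hx hA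
  have h₃ := mul_le_mul_of_nonneg_left hw ha.le
  nlinarith

end Smooth

/-- The variational inequality for a nearest point of a convex set. -/
theorem real_inner_le_zero_of_forall_norm_sub_le {E : Type*} [NormedAddCommGroup E]
    [InnerProductSpace ℝ E] {K : Set E} (hK : Convex ℝ K) {u v : E} (hv : v ∈ K)
    (hmin : ∀ w ∈ K, ‖v - u‖ ≤ ‖w - u‖) {w : E} (hw : w ∈ K) : ⟪u - v, w - v⟫ ≤ 0 := by
  have : Nonempty K := ⟨⟨v, hv⟩⟩
  refine (norm_eq_iInf_iff_real_inner_le_zero hK hv).1 (le_antisymm ?_ ?_) w hw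
  · refine le_ciInf fun w => ?_
    simpa only [norm_sub_rev u] using hmin w w.2
  · exact ciInf_le (f := fun w : K => ‖u - w‖)
      ⟨0, Set.forall_mem_range.2 fun _ => norm_nonneg _⟩ ⟨v, hv⟩

theorem agm_bio_displacement_sum
    {n : ℕ} {f g : EuclideanSpace ℝ (Fin n) → ℝ}
    {f' g' : EuclideanSpace ℝ (Fin n) → EuclideanSpace ℝ (Fin n)}
    {Z : Set (EuclideanSpace ℝ (Fin n))}
    {L_f L_g : ℝ} (hLf : 0 < L_f) (hLg : 0 < L_g)
    (hZconv : Convex ℝ Z) (hZcl : IsClosed Z)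
    (hfconv : ConvexOn ℝ Set.univ f) (hgconv : ConvexOn ℝ Set.univ g)
    (hf' : ∀ w, HasGradientAt f (f' w) w)
    (hg' : ∀ w, HasGradientAt g (g' w) w)
    (hLipf : ∀ u v, ‖f' u - f' v‖ ≤ L_f * ‖u - v‖)
    (hLipg : ∀ u v, ‖g' u - g' v‖ ≤ L_g * ‖u - v‖)
    {xstar : EuclideanSpace ℝ (Fin n)}
    (hxZ : xstar ∈ Z)
    (hxlow : ∀ w ∈ Z, g xstar ≤ g w)
    (hxopt : ∀ w ∈ Z, (∀ u ∈ Z, g w ≤ g u) → f xstar ≤ f w)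
    {x z y : ℕ → EuclideanSpace ℝ (Fin n)} {A a gs : ℕ → ℝ}
    (hA0 : A 0 = 0) (hxz0 : x 0 = z 0)
    (ha : ∀ k : ℕ, a k = ((k : ℝ) + 1) / (4 * L_f))
    (hArec : ∀ k, A (k + 1) = A k + a k)
    (hy : ∀ k, y k = (A k / (A k + a k)) • x k + (a k / (A k + a k)) • z k)
    (hgs : ∀ k, g xstar ≤ gs k)
    (hzmem : ∀ k, z (k + 1) ∈ Z ∧ g (y k) + ⟪g' (y k), z (k + 1) - y k⟫ ≤ gs k)
    (hzproj : ∀ k, ∀ w ∈ Z, g (y k) + ⟪g' (y k), w - y k⟫ ≤ gs k →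
        ‖z (k + 1) - (z k - a k • f' (y k))‖ ≤ ‖w - (z k - a k • f' (y k))‖)
    (hxrec : ∀ k, x (k + 1) = (A k / (A k + a k)) • x k + (a k / (A k + a k)) • z (k + 1)) :
    ∀ k : ℕ, 1 ≤ k → f xstar ≤ f (x k) →
      ∑ i ∈ Finset.range k, ‖z (i + 1) - z i‖ ^ 2 ≤ 2 * ‖z 0 - xstar‖ ^ 2 := by
  have hA (k : ℕ) : A k = (k : ℝ) * (k + 1) / (8 * L_f) := by
    induction k with
    | zero => simp [hA0]
    | succ k ih => rw [hArec, ih, ha]; push_cast; field_simp; ring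
  have hstep (k : ℕ) : 2 * L_f * a k ^ 2 ≤ A k + a k := by
    rw [hA, ha, ← sub_nonneg]
    have : (k : ℝ) * (k + 1) / (8 * L_f) + (k + 1) / (4 * L_f) -
        2 * L_f * ((k + 1) / (4 * L_f)) ^ 2 = (k + 1) / (8 * L_f) := by
      field_simp; ring
    rw [this]
    positivity
  have hmem (k : ℕ) : g (y k) + ⟪g' (y k), xstar - y k⟫ ≤ gs k :=
    (hgconv.add_inner_gradient_le hg' _ _).trans (hgs k)
  have hconv (k : ℕ) : Convex ℝ (Z ∩ {w | g (y k) + ⟪g' (y k), w - y k⟫ ≤ gs k}) := by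
    have hset : {w | g (y k) + ⟪g' (y k), w - y k⟫ ≤ gs k} =
        {w | innerSL ℝ (g' (y k)) w ≤ gs k - g (y k) + ⟪g' (y k), y k⟫} := by
      ext w
      simp only [Set.mem_ofPred_eq, innerSL_apply_apply, inner_sub_right]
      constructor <;> intro h <;> linarith
    rw [hset]
    exact hZconv.inter (convex_halfSpace_le (innerSL ℝ (g' (y k))).isLinear _)
  have hpotential (k : ℕ) := accelerated_step_potential_le hfconv hf' hLipf
    (by rw [hA]; positivity) (by rw [ha]; positivity) (hstep k) (hy k) (hxrec k)
    (real_inner_le_zero_of_forall_norm_sub_le (hconv k) (hzmem k)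
      (fun w hw => hzproj k w hw.1 hw.2) ⟨hxZ, hmem k⟩)
  have hsum (k : ℕ) : A k * (f (x k) - f xstar) + ‖z k - xstar‖ ^ 2 / 2 +
      (∑ i ∈ Finset.range k, ‖z (i + 1) - z i‖ ^ 2) / 4 ≤ ‖z 0 - xstar‖ ^ 2 / 2 := by
    induction k with
    | zero => simp [hA0]
    | succ k ih =>
      rw [Finset.sum_range_succ, hArec]
      linarith [hpotential k]
  intro k _ hk
  have hAk : 0 ≤ A k := by rw [hA]; positivity
  have := mul_nonneg hAk (sub_nonneg.2 hk)
  linarith [hsum k, sq_nonneg ‖z k - xstar‖]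
end

section
/- Let f : ℝ^n → ℝ be convex and differentiable, let x*, x_k, z_k ∈ ℝ^n, A_k ≥ 0, a_k > 0, A_{k+1} = A_k + a_k, and y_k = (A_k x_k + a_k z_k)/(A_k + a_k). Then A_{k+1}(f(y_k) − f(x*)) − A_k(f(x_k) − f(x*)) ≤ a_k ⟨∇f(y_k), z_k − x*⟩. -/
open RealInnerProductSpace

/-- The first-order condition: a convex function lies above its tangent hyperplanes. -/
theorem ConvexOn.add_inner_gradient_le_s18 {E : Type*} [NormedAddCommGroup E]
    [InnerProductSpace ℝ E] [CompleteSpace E] {f : E → ℝ} {g x : E}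
    (hf : ConvexOn ℝ Set.univ f) (hg : HasGradientAt f g x) (y : E) :
    f x + ⟪g, y - x⟫ ≤ f y := by
  have hconv : ConvexOn ℝ Set.univ (f ∘ AffineMap.lineMap (k := ℝ) x y) := by
    simpa using hf.comp_affineMap (AffineMap.lineMap (k := ℝ) x y)
  have hg' : HasFDerivAt f (InnerProductSpace.toDual ℝ E g)
      (AffineMap.lineMap (k := ℝ) x y 0) := by
    simpa using hg.hasFDerivAt
  have hderiv : HasDerivAt (f ∘ AffineMap.lineMap (k := ℝ) x y) ⟪g, y - x⟫ 0 := by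
    simpa using hg'.comp_hasDerivAt (0 : ℝ) AffineMap.hasDerivAt_lineMap
  have hslope := hconv.le_slope_of_hasDerivAt (Set.mem_univ 0) (Set.mem_univ 1) one_pos hderiv
  simp [slope_def_field] at hslope
  linarith

theorem accelerated_estimate_sequence_step
    {n : ℕ} {f : EuclideanSpace ℝ (Fin n) → ℝ} {f' : EuclideanSpace ℝ (Fin n) → EuclideanSpace ℝ (Fin n)}
    (hfconv : ConvexOn ℝ Set.univ f)
    (hf' : ∀ w, HasGradientAt f (f' w) w)
    (xstar xk zk : EuclideanSpace ℝ (Fin n)) {Ak ak : ℝ} (hAk : 0 ≤ Ak) (hak : 0 < ak) :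
    (Ak + ak) * (f ((Ak / (Ak + ak)) • xk + (ak / (Ak + ak)) • zk) - f xstar) -
        Ak * (f xk - f xstar) ≤
      ak * ⟪f' ((Ak / (Ak + ak)) • xk + (ak / (Ak + ak)) • zk), zk - xstar⟫ := by
  have hpos : Ak + ak ≠ 0 := by positivity
  set y := (Ak / (Ak + ak)) • xk + (ak / (Ak + ak)) • zk with hy
  have hcomb : (Ak + ak) • y = Ak • xk + ak • zk := by
    rw [hy, smul_add, smul_smul, smul_smul, mul_div_cancel₀ _ hpos, mul_div_cancel₀ _ hpos]
  have hinner := congrArg (fun v => ⟪f' y, v⟫) hcomb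
  simp only [inner_add_right, real_inner_smul_right] at hinner
  have hx := mul_le_mul_of_nonneg_left (hfconv.add_inner_gradient_le_s18 (hf' y) xk) hAk
  have hstar := mul_le_mul_of_nonneg_left (hfconv.add_inner_gradient_le_s18 (hf' y) xstar) hak.le
  rw [inner_sub_right] at hx hstar ⊢
  linarith
end
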